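/- arXiv:1808.09754 — 3 statements merged into one kernel-verified Lean document; each statement's English description precedes it below -/
import Mathlib

section
/- Let τ ≥ 1 and let ρ_min be a minimizing measure with support M. For every N ∈ ℕ and all points p₀, …, p_N ∈ M, the (N+1)×(N+1) real matrix with entries L(p_i, p_j), 0 ≤ i, j ≤ N, is symmetric and positive semi-definite. -/
open MeasureTheory Set
open scoped RealInnerProductSpace ENNReal

noncomputable section

/-- Euclidean three-space. -/
abbrev E3 := EuclideanSpace ℝ (Fin 3)

/-- The unit sphere `S² ⊂ ℝ³`. -/
def Sphere2 : Set E3 := Metric.sphere 0 1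

/-- The function `D(x,y) = (1/4)(1+⟨x,y⟩)(2 − τ²(1−⟨x,y⟩))`. -/
def Dfun (τ : ℝ) (x y : E3) : ℝ :=
  (1 / 4) * (1 + ⟪x, y⟫) * (2 - τ ^ 2 * (1 - ⟪x, y⟫))

/-- The Lagrangian `L = max(0, D)`. -/
def Lfun (τ : ℝ) (x y : E3) : ℝ := max 0 (Dfun τ x y)

/-- The causal action of a measure. -/
def causalAction (τ : ℝ) (ρ : Measure E3) : ℝ :=
  ∫ x, ∫ y, Lfun τ x y ∂ρ ∂ρ

/-- `ρ` is a minimizing measure: a regular Borel probability measure supported on `S²`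
minimizing the causal action among all such measures. -/
def IsMinimizer (τ : ℝ) (ρ : Measure E3) : Prop :=
  IsProbabilityMeasure ρ ∧ ρ.Regular ∧ ρ Sphere2ᶜ = 0 ∧
    ∀ ρ' : Measure E3, IsProbabilityMeasure ρ' → ρ'.Regular → ρ' Sphere2ᶜ = 0 →
      causalAction τ ρ ≤ causalAction τ ρ'

/-- The support of a measure. -/
def msupport (ρ : Measure E3) : Set E3 :=
  {x | ∀ U : Set E3, IsOpen U → x ∈ U → 0 < ρ U}

/-- The opening angle `θ_max = arccos(1 − 2/τ²)`. -/
def θmax (τ : ℝ) : ℝ := Real.arccos (1 - 2 / τ ^ 2)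

/-- The open light cone `I(p)`. -/
def lightConeI (τ : ℝ) (p : E3) : Set E3 := {q ∈ Sphere2 | 0 < Dfun τ p q}

/-- The boundary of the light cone `K(p)`. -/
def lightConeK (τ : ℝ) (p : E3) : Set E3 :=
  {q ∈ Sphere2 | ⟪p, q⟫ = Real.cos (θmax τ)}

/-- Make a point of `ℝ³` from coordinates. -/
def mkE3 (a b c : ℝ) : E3 := (WithLp.equiv 2 (Fin 3 → ℝ)).symm ![a, b, c]

/-- A totally timelike set. -/
def TotallyTimelike (τ : ℝ) (Ω : Set E3) : Prop := ∀ x ∈ Ω, ∀ y ∈ Ω, 0 < Dfun τ x y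

/-- `p` is an accumulation point of `A`: every neighborhood of `p` contains a point
of `A` different from `p`. -/
def AccumulationPt (p : E3) (A : Set E3) : Prop :=
  ∀ U ∈ nhds p, ∃ x ∈ A, x ∈ U ∧ x ≠ p

/-- `γ(0)` is a uniform two-sided accumulation point (of points of `M`) on `γ` of
scaling `β`, where `γ` is defined on `(−δ, δ)`. -/
def UniformTwoSidedAcc (M : Set E3) (β δ : ℝ) (γ : ℝ → E3) : Prop :=
  ∃ ε₀ : ℝ, 0 < ε₀ ∧ ε₀ < δ ∧ ∀ ε : ℝ, 0 < ε → ε ≤ ε₀ →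
    (∃ t ∈ Set.Ioo (-ε) (-(ε ^ (1 + β))), γ t ∈ M) ∧
    (∃ t ∈ Set.Ioo (ε ^ (1 + β)) ε, γ t ∈ M)

/-- The point `q₁ = (cos θ_max, 0, sin θ_max)`. -/
def q1pt (τ : ℝ) : E3 := mkE3 (Real.cos (θmax τ)) 0 (Real.sin (θmax τ))

/-- The point `q₂ = (cos θ_max, 0, −sin θ_max)`. -/
def q2pt (τ : ℝ) : E3 := mkE3 (Real.cos (θmax τ)) 0 (-Real.sin (θmax τ))

/-- The curve `p_s = (cos s, sin s, 0)` along the equator. -/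
def pcurve (s : ℝ) : E3 := mkE3 (Real.cos s) (Real.sin s) 0

/-- Geodesic ball in `S²` of radius `r` around `q`. -/
def geoBall (q : E3) (r : ℝ) : Set E3 := {x ∈ Sphere2 | Real.arccos ⟪q, x⟫ < r}

/-- The set `U_r = (B_r(q₁) ∪ B_r(q₂)) ∖ {q₁, q₂}`. -/
def Uset (τ r : ℝ) : Set E3 := (geoBall (q1pt τ) r ∪ geoBall (q2pt τ) r) \ {q1pt τ, q2pt τ}

/-- The set `I_r(q) = I(q) ∖ U_r`. -/
def Iset (τ r : ℝ) (q : E3) : Set E3 := lightConeI τ q \ Uset τ r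

/-- The point of `S²` with latitude `θ` (measured from the equator) and longitude `φ`. -/
def sphPt (θ φ : ℝ) : E3 :=
  mkE3 (Real.cos θ * Real.cos φ) (Real.cos θ * Real.sin φ) (Real.sin θ)

/-- The restrictions to `Ω` of polynomials of degree at most two on `ℝ³`. -/
def polyRestrictSet (Ω : Set E3) : Set (Ω → ℝ) :=
  {f | ∃ P : MvPolynomial (Fin 3) ℝ, P.totalDegree ≤ 2 ∧
        ∀ x : Ω, f x = MvPolynomial.eval (fun i => (x : E3) i) P}

/-- The space `K(Ω)` of restrictions to `Ω` of polynomials of degree at most two. -/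
def KSpace (Ω : Set E3) : Submodule ℝ (Ω → ℝ) := Submodule.span ℝ (polyRestrictSet Ω)

/-- Two-dimensional Hausdorff (surface) measure on `S²` restricted to `Ω`, as a
measure on `Ω`. -/
def surfΩ (Ω : Set E3) : Measure Ω := Measure.comap Subtype.val (μH[2] : Measure E3)

/-- The bilinear form `B(f,g) = ∫_Ω ∫_Ω D(x,y) f(x) g(y) dμ(x) dμ(y)` on functions on `Ω`. -/
def Bform (τ : ℝ) (Ω : Set E3) (f g : Ω → ℝ) : ℝ :=
  ∫ x, ∫ y, Dfun τ (x : E3) (y : E3) * f x * g y ∂(surfΩ Ω) ∂(surfΩ Ω)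

end

lemma aux_cont (τ : ℝ) : Continuous (fun z : E3 × E3 => Lfun τ z.1 z.2) := by
  unfold Lfun Dfun; fun_prop

lemma aux_symm (τ : ℝ) (x y : E3) : Lfun τ x y = Lfun τ y x := by
  unfold Lfun Dfun; rw [real_inner_comm]

lemma aux_nonneg (τ : ℝ) (x y : E3) : 0 ≤ Lfun τ x y := le_max_left _ _

lemma aux_bdd (τ : ℝ) : ∃ C, ∀ x ∈ Sphere2, ∀ y ∈ Sphere2, ‖Lfun τ x y‖ ≤ C := by
  have hc : IsCompact (Sphere2 ×ˢ Sphere2) := (isCompact_sphere (0:E3) 1).prod (isCompact_sphere (0:E3) 1)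
  obtain ⟨C, hC⟩ := hc.exists_bound_of_continuousOn (aux_cont τ).continuousOn
  exact ⟨C, fun x hx y hy => hC (x, y) ⟨hx, hy⟩⟩

lemma aux_ae (ρ : Measure E3) [IsProbabilityMeasure ρ] (h0 : ρ Sphere2ᶜ = 0) :
    ∀ᵐ z ∂(ρ.prod ρ), z.1 ∈ Sphere2 ∧ z.2 ∈ Sphere2 := by
  have h1 : ∀ᵐ x ∂ρ, x ∈ Sphere2 := h0
  have a := (Measure.quasiMeasurePreserving_fst (μ := ρ) (ν := ρ)).ae h1
  have b := (Measure.quasiMeasurePreserving_snd (μ := ρ) (ν := ρ)).ae h1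
  filter_upwards [a, b] with z h1 h2 using ⟨h1, h2⟩

lemma aux_int (τ : ℝ) (ρ : Measure E3) [IsProbabilityMeasure ρ] (h0 : ρ Sphere2ᶜ = 0)
    (g : E3 × E3 → ℝ) (hg : Measurable g) (C : ℝ) (hC : ∀ z, |g z| ≤ C) :
    Integrable (fun z : E3 × E3 => g z * Lfun τ z.1 z.2) (ρ.prod ρ) := by
  obtain ⟨K, hK⟩ := aux_bdd τ
  refine Integrable.of_bound (C := C * K)
    (hg.mul (aux_cont τ).measurable).aestronglyMeasurable ?_
  filter_upwards [aux_ae ρ h0] with z hz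
  rw [norm_mul]
  exact mul_le_mul (hC z) (hK _ hz.1 _ hz.2) (norm_nonneg _) ((abs_nonneg _).trans (hC z))

lemma auxA (τ : ℝ) (ρ : Measure E3) (hmin : IsMinimizer τ ρ) (h : E3 → ℝ) (hm : Measurable h)
    (h1 : ∀ x, 1 / 2 ≤ h x) (h2 : ∀ x, h x ≤ 3 / 2) :
    (∫ x, h x ∂ρ) ^ 2 * causalAction τ ρ ≤
      ∫ z : E3 × E3, (h z.1 * h z.2) * Lfun τ z.1 z.2 ∂(ρ.prod ρ) := by
  obtain ⟨hP, hR, h0, hM⟩ := hmin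
  have hi : Integrable h ρ := by
    refine Integrable.of_bound (C := 3 / 2) hm.aestronglyMeasurable (Filter.Eventually.of_forall ?_)
    intro x
    rw [Real.norm_eq_abs, abs_le]
    constructor <;> linarith [h1 x, h2 x]
  set m := ∫ x, h x ∂ρ with hmdef
  have hmpos : 0 < m := by
    have : ∫ x, (1 / 2 : ℝ) ∂ρ ≤ m := integral_mono (integrable_const _) hi h1
    simp at this
    linarith
  let k : E3 → NNReal := fun x => Real.toNNReal (h x / m)
  have hk : Measurable k := (hm.div_const m).real_toNNReal
  have hkv : ∀ x, ((k x : NNReal) : ℝ) = h x / m := fun x =>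
    Real.coe_toNNReal _ (div_nonneg (by linarith [h1 x]) hmpos.le)
  let ρ' : Measure E3 := ρ.withDensity (fun x => (k x : ℝ≥0∞))
  have hP' : IsProbabilityMeasure ρ' := by
    constructor
    rw [withDensity_apply _ MeasurableSet.univ, Measure.restrict_univ]
    have : ∫⁻ x, ENNReal.ofReal (h x / m) ∂ρ = ENNReal.ofReal (∫ x, h x / m ∂ρ) := by
      rw [ofReal_integral_eq_lintegral_ofReal (hi.div_const m)]
      exact Filter.Eventually.of_forall fun x => div_nonneg (by linarith [h1 x]) hmpos.le
    rw [integral_div, div_self hmpos.ne', ENNReal.ofReal_one] at this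
    exact this
  have h0' : ρ' Sphere2ᶜ = 0 := withDensity_absolutelyContinuous _ _ h0
  have key := hM ρ' hP' inferInstance h0'
  have e : causalAction τ ρ' =
      (∫ z : E3 × E3, (h z.1 * h z.2) * Lfun τ z.1 z.2 ∂(ρ.prod ρ)) / m ^ 2 := by
    have hint := aux_int τ ρ h0 (fun z => h z.1 * h z.2)
      ((hm.comp measurable_fst).mul (hm.comp measurable_snd)) (3 / 2 * (3 / 2)) (by
        intro z
        rw [abs_of_nonneg (mul_nonneg (by linarith [h1 z.1]) (by linarith [h1 z.2]))]
        exact mul_le_mul (h2 _) (h2 _) (by linarith [h1 z.2]) (by norm_num))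
    rw [integral_prod _ hint, ← integral_div]
    unfold causalAction
    rw [integral_withDensity_eq_integral_smul hk]
    congr 1
    ext x
    rw [integral_withDensity_eq_integral_smul hk, ← integral_div, NNReal.smul_def, smul_eq_mul,
      ← integral_const_mul]
    congr 1
    ext y
    rw [NNReal.smul_def, smul_eq_mul, hkv, hkv]
    field_simp
  rw [e, le_div_iff₀ (by positivity)] at key
  linarith

lemma auxB (τ : ℝ) (ρ : Measure E3) (hmin : IsMinimizer τ ρ) (f : E3 → ℝ) (hf : Measurable f)
    (h1 : ∀ x, |f x| ≤ 1 / 2) :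
    0 ≤ ∫ z : E3 × E3, (f z.1 * f z.2) * Lfun τ z.1 z.2 ∂(ρ.prod ρ) := by
  have a := auxA τ ρ hmin (fun x => 1 + f x) (by fun_prop)
    (fun x => by linarith [(abs_le.1 (h1 x)).1]) (fun x => by linarith [(abs_le.1 (h1 x)).2])
  have b := auxA τ ρ hmin (fun x => 1 - f x) (by fun_prop)
    (fun x => by linarith [(abs_le.1 (h1 x)).2]) (fun x => by linarith [(abs_le.1 (h1 x)).1])
  obtain ⟨hP, hR, h0, hM⟩ := hmin
  have hfi : Integrable f ρ :=
    Integrable.of_bound (C := 1 / 2) hf.aestronglyMeasurable (Filter.Eventually.of_forall h1)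
  have hS : causalAction τ ρ = ∫ z : E3 × E3, 1 * Lfun τ z.1 z.2 ∂(ρ.prod ρ) := by
    rw [integral_prod _ (aux_int τ ρ h0 (fun _ => 1) measurable_const 1 (by simp))]
    simp [causalAction]
  have hSn : 0 ≤ causalAction τ ρ :=
    integral_nonneg fun x => integral_nonneg fun y => aux_nonneg τ x y
  have i1 := aux_int τ ρ h0 (fun _ => 1) measurable_const 1 (by simp)
  have i2 := aux_int τ ρ h0 (fun z => f z.1 + f z.2) (by fun_prop) 1 (by
    intro z; exact (abs_add_le _ _).trans (by linarith [h1 z.1, h1 z.2]))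
  have i3 := aux_int τ ρ h0 (fun z => f z.1 * f z.2) (by fun_prop) (1 / 2 * (1 / 2)) (by
    intro z; rw [abs_mul]; exact mul_le_mul (h1 _) (h1 _) (abs_nonneg _) (by norm_num))
  have ea : ∫ z : E3 × E3, ((1 + f z.1) * (1 + f z.2)) * Lfun τ z.1 z.2 ∂(ρ.prod ρ) =
      (∫ z : E3 × E3, 1 * Lfun τ z.1 z.2 ∂(ρ.prod ρ)) +
      (∫ z : E3 × E3, (f z.1 + f z.2) * Lfun τ z.1 z.2 ∂(ρ.prod ρ)) +
      ∫ z : E3 × E3, (f z.1 * f z.2) * Lfun τ z.1 z.2 ∂(ρ.prod ρ) := by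
    rw [← integral_add' i1 i2, ← integral_add' (i1.add i2) i3]
    congr 1; ext z; simp only [Pi.add_apply]; ring
  have eb : ∫ z : E3 × E3, ((1 - f z.1) * (1 - f z.2)) * Lfun τ z.1 z.2 ∂(ρ.prod ρ) =
      (∫ z : E3 × E3, 1 * Lfun τ z.1 z.2 ∂(ρ.prod ρ)) -
      (∫ z : E3 × E3, (f z.1 + f z.2) * Lfun τ z.1 z.2 ∂(ρ.prod ρ)) +
      ∫ z : E3 × E3, (f z.1 * f z.2) * Lfun τ z.1 z.2 ∂(ρ.prod ρ) := by
    rw [← integral_sub' i1 i2, ← integral_add' (i1.sub i2) i3]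
    congr 1; ext z; simp only [Pi.sub_apply, Pi.add_apply]; ring
  rw [ea, ← hS, integral_add (integrable_const _) hfi] at a
  rw [eb, ← hS, integral_sub (integrable_const _) hfi] at b
  simp only [integral_const, probReal_univ, smul_eq_mul, mul_one] at a b
  nlinarith [mul_nonneg (sq_nonneg (∫ x, f x ∂ρ)) hSn]

lemma auxC (τ : ℝ) (ρ : Measure E3) (hmin : IsMinimizer τ ρ) (f : E3 → ℝ) (hf : Measurable f)
    (C : ℝ) (h1 : ∀ x, |f x| ≤ C) :
    0 ≤ ∫ z : E3 × E3, (f z.1 * f z.2) * Lfun τ z.1 z.2 ∂(ρ.prod ρ) := by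
  have hC : 0 ≤ C := (abs_nonneg _).trans (h1 0)
  set a : ℝ := 1 / (2 * C + 1) with ha
  have hap : 0 < a := by positivity
  have := auxB τ ρ hmin (fun x => a * f x) (by fun_prop) (by
    intro x
    rw [abs_mul, abs_of_pos hap, ha, one_div_mul_eq_div, div_le_iff₀ (by positivity)]
    linarith [h1 x])
  have e : ∫ z : E3 × E3, ((a * f z.1) * (a * f z.2)) * Lfun τ z.1 z.2 ∂(ρ.prod ρ) =
      a ^ 2 * ∫ z : E3 × E3, (f z.1 * f z.2) * Lfun τ z.1 z.2 ∂(ρ.prod ρ) := by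
    rw [← integral_const_mul]
    congr 1; ext z; ring
  rw [e] at this
  exact nonneg_of_mul_nonneg_right this (by positivity)

lemma auxD (τ : ℝ) (ρ : Measure E3) (hmin : IsMinimizer τ ρ) (N : ℕ)
    (p : Fin (N + 1) → E3) (hp : ∀ i, p i ∈ msupport ρ) (c : Fin (N + 1) → ℝ) :
    0 ≤ ∑ i, ∑ j, c i * c j * Lfun τ (p i) (p j) := by
  have hmin' := hmin
  obtain ⟨hP, hR, h0, hM⟩ := hmin'
  -- it suffices to bound from below by `-ε * K`
  suffices H : ∀ ε > 0, -(ε * ∑ i, ∑ j, |c i * c j|) ≤ ∑ i, ∑ j, c i * c j * Lfun τ (p i) (p j) by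
    by_contra hneg
    push Not at hneg
    set T := ∑ i, ∑ j, c i * c j * Lfun τ (p i) (p j)
    set K := ∑ i, ∑ j, |c i * c j| with hK
    have hKn : 0 ≤ K := Finset.sum_nonneg fun i _ => Finset.sum_nonneg fun j _ => abs_nonneg _
    have := H (-T / (K + 1)) (div_pos (by linarith) (by linarith))
    rw [div_mul_eq_mul_div, neg_le, le_div_iff₀ (by linarith)] at this
    nlinarith
  intro ε hε
  have hr : ∀ᶠ r in nhdsWithin (0:ℝ) (Ioi 0), ∀ i j, ∀ z : E3 × E3,
      z.1 ∈ Metric.ball (p i) r → z.2 ∈ Metric.ball (p j) r →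
        |Lfun τ z.1 z.2 - Lfun τ (p i) (p j)| ≤ ε := by
    rw [Filter.eventually_all]; intro i
    rw [Filter.eventually_all]; intro j
    obtain ⟨d, hd, hd'⟩ := Metric.continuousAt_iff.1 ((aux_cont τ).continuousAt (x := (p i, p j))) ε hε
    filter_upwards [Ioo_mem_nhdsGT hd] with r hr z hz1 hz2
    refine (hd' (x := z) ?_).le
    rw [Prod.dist_eq]
    exact max_lt ((Metric.mem_ball.1 hz1).trans hr.2) ((Metric.mem_ball.1 hz2).trans hr.2)
  obtain ⟨r, hr, hr0⟩ := (hr.and self_mem_nhdsWithin).exists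
  replace hr0 : 0 < r := hr0
  let U : Fin (N + 1) → Set E3 := fun i => Metric.ball (p i) r
  have hU : ∀ i, MeasurableSet (U i) := fun i => measurableSet_ball
  have hUpos : ∀ i, 0 < ρ.real (U i) := fun i =>
    ENNReal.toReal_pos (hp i _ Metric.isOpen_ball (Metric.mem_ball_self hr0)).ne' (measure_ne_top _ _)
  let g : Fin (N + 1) → E3 → ℝ := fun i => (U i).indicator (fun _ => (ρ.real (U i))⁻¹)
  have hgm : ∀ i, Measurable (g i) := fun i => measurable_const.indicator (hU i)
  have hgn : ∀ i x, 0 ≤ g i x := fun i x => indicator_nonneg (fun _ _ => (inv_pos.2 (hUpos i)).le) x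
  have hgb : ∀ i x, g i x ≤ (ρ.real (U i))⁻¹ := fun i x =>
    indicator_le_self' (fun _ _ => (inv_pos.2 (hUpos i)).le) x
  have hg1 : ∀ i, ∫ x, g i x ∂ρ = 1 := by
    intro i
    rw [integral_indicator (hU i), setIntegral_const, smul_eq_mul, mul_inv_cancel₀ (hUpos i).ne']
  have hgi : ∀ i, Integrable (g i) ρ := fun i => (integrable_const _).indicator (hU i)
  have hI : ∀ i j, Integrable (fun z : E3 × E3 => (g i z.1 * g j z.2) * Lfun τ z.1 z.2) (ρ.prod ρ) := by
    intro i j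
    refine aux_int τ ρ h0 (fun z => g i z.1 * g j z.2)
      (((hgm i).comp measurable_fst).mul ((hgm j).comp measurable_snd))
      ((ρ.real (U i))⁻¹ * (ρ.real (U j))⁻¹) ?_
    intro z
    rw [abs_of_nonneg (mul_nonneg (hgn _ _) (hgn _ _))]
    exact mul_le_mul (hgb _ _) (hgb _ _) (hgn _ _) (inv_pos.2 (hUpos i)).le
  have hI0 : ∀ i j, Integrable (fun z : E3 × E3 => g i z.1 * g j z.2) (ρ.prod ρ) :=
    fun i j => (hgi i).mul_prod (hgi j)
  have hI1 : ∀ i j, ∫ z : E3 × E3, g i z.1 * g j z.2 ∂(ρ.prod ρ) = 1 := by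
    intro i j
    rw [integral_prod_mul, hg1, hg1, one_mul]
  let A : Fin (N + 1) → Fin (N + 1) → ℝ := fun i j =>
    ∫ z : E3 × E3, (g i z.1 * g j z.2) * Lfun τ z.1 z.2 ∂(ρ.prod ρ)
  have hA : ∀ i j, |A i j - Lfun τ (p i) (p j)| ≤ ε := by
    intro i j
    have e : A i j - Lfun τ (p i) (p j) = ∫ z : E3 × E3,
        (g i z.1 * g j z.2) * (Lfun τ z.1 z.2 - Lfun τ (p i) (p j)) ∂(ρ.prod ρ) := by
      simp only [mul_sub]
      rw [integral_sub (hI i j) ((hI0 i j).mul_const _), integral_mul_const, hI1, one_mul]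
    rw [e, ← Real.norm_eq_abs]
    calc _ ≤ ∫ z : E3 × E3, (g i z.1 * g j z.2) * ε ∂(ρ.prod ρ) := by
          refine norm_integral_le_of_norm_le ((hI0 i j).mul_const _) (Filter.Eventually.of_forall ?_)
          intro z
          rw [norm_mul, Real.norm_of_nonneg (mul_nonneg (hgn _ _) (hgn _ _)), Real.norm_eq_abs]
          by_cases h1 : z.1 ∈ U i
          · by_cases h2 : z.2 ∈ U j
            · exact mul_le_mul_of_nonneg_left (hr i j z h1 h2) (mul_nonneg (hgn _ _) (hgn _ _))
            · simp [g, h2]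
          · simp [g, h1]
      _ = ε := by rw [integral_mul_const, hI1, one_mul]
  have hQ := auxC τ ρ hmin (fun x => ∑ i, c i * g i x)
    (Finset.measurable_sum _ fun i _ => (hgm i).const_mul _)
    (∑ i, |c i| * (ρ.real (U i))⁻¹) (by
      intro x
      refine (Finset.abs_sum_le_sum_abs _ _).trans (Finset.sum_le_sum fun i _ => ?_)
      rw [abs_mul, abs_of_nonneg (hgn i x)]
      exact mul_le_mul_of_nonneg_left (hgb _ _) (abs_nonneg _))
  have eQ : ∫ z : E3 × E3, ((∑ i, c i * g i z.1) * (∑ i, c i * g i z.2)) * Lfun τ z.1 z.2 ∂(ρ.prod ρ)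
      = ∑ i, ∑ j, c i * c j * A i j := by
    have : ∀ z : E3 × E3, ((∑ i, c i * g i z.1) * (∑ i, c i * g i z.2)) * Lfun τ z.1 z.2 =
        ∑ i, ∑ j, c i * c j * ((g i z.1 * g j z.2) * Lfun τ z.1 z.2) := by
      intro z
      rw [Finset.sum_mul_sum, Finset.sum_mul]
      refine Finset.sum_congr rfl fun i _ => ?_
      rw [Finset.sum_mul]
      refine Finset.sum_congr rfl fun j _ => ?_
      ring
    simp only [this]
    rw [integral_finsetSum _ fun i _ => integrable_finsetSum _ fun j _ => (hI i j).const_mul _]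
    refine Finset.sum_congr rfl fun i _ => ?_
    rw [integral_finsetSum _ fun j _ => (hI i j).const_mul _]
    refine Finset.sum_congr rfl fun j _ => ?_
    rw [integral_const_mul]
  rw [eQ] at hQ
  have hle : ∑ i, ∑ j, c i * c j * A i j ≤
      ∑ i, ∑ j, (c i * c j * Lfun τ (p i) (p j) + ε * |c i * c j|) := by
    refine Finset.sum_le_sum fun i _ => Finset.sum_le_sum fun j _ => ?_
    have : c i * c j * (A i j - Lfun τ (p i) (p j)) ≤ |c i * c j| * ε := by
      refine (le_abs_self _).trans ?_
      rw [abs_mul]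
      exact mul_le_mul_of_nonneg_left (hA i j) (abs_nonneg _)
    linarith
  simp only [Finset.sum_add_distrib, ← Finset.mul_sum] at hle
  linarith

/-- Corollary 3.4: the Gram matrix of finitely many support points is
symmetric and positive semi-definite. -/
theorem stmt_3 (τ : ℝ) (hτ : 1 ≤ τ) (ρ : Measure E3) (hmin : IsMinimizer τ ρ)
    (N : ℕ) (p : Fin (N + 1) → E3) (hp : ∀ i, p i ∈ msupport ρ) :
    (Matrix.of fun i j => Lfun τ (p i) (p j)).IsSymm ∧
    (Matrix.of fun i j => Lfun τ (p i) (p j)).PosSemidef := by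
  have hs : (Matrix.of fun i j => Lfun τ (p i) (p j)).IsSymm := by
    ext i j
    simp [aux_symm τ (p i) (p j)]
  refine ⟨hs, ?_⟩
  refine Matrix.PosSemidef.of_dotProduct_mulVec_nonneg ?_ ?_
  · ext i j
    simp [aux_symm τ (p i) (p j)]
  · intro c
    have := auxD τ ρ hmin N p hp c
    simp only [dotProduct, Matrix.mulVec, Finset.mul_sum, Matrix.of_apply, Pi.star_apply, star_trivial]
    refine this.trans_eq (Finset.sum_congr rfl fun i _ => Finset.sum_congr rfl fun j _ => ?_)
    ring
end

section
/- Let τ > √3, let Ω ⊆ S² be a nonempty open totally timelike set, and let μ be the two-dimensional Hausdorff (surface) measure on S² restricted to Ω. Then K(Ω) has dimension 9, and the symmetric bilinear form B(f,g) = ∫_Ω∫_Ω D(x,y) f(x) g(y) dμ(x) dμ(y) on K(Ω) is nondegenerate with signature (8,1): there is a direct sum decomposition K(Ω) = V₊ ⊕ V₋ with dim V₊ = 8 and dim V₋ = 1 such that B is positive definite on V₊ and negative definite on V₋. -/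
open MeasureTheory Set
open scoped RealInnerProductSpace ENNReal

lemma absLin {V : Type*} [AddCommGroup V] [Module ℝ V] (K : Submodule ℝ V)
    (Φ : K ≃ₗ[ℝ] (Fin 9 → ℝ)) (B : V → V → ℝ) (d : Fin 9 → ℝ) (h0 : d 0 < 0)
    (hd : ∀ k : Fin 8, 0 < d k.succ)
    (hB : ∀ f g : K, B f g = ∑ k, d k * Φ f k * Φ g k) :
    Module.finrank ℝ K = 9 ∧
    (∀ f ∈ K, (∀ g ∈ K, B f g = 0) → f = 0) ∧
    ∃ Vp Vm : Submodule ℝ V,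
      Vp ≤ K ∧ Vm ≤ K ∧
      Module.finrank ℝ Vp = 8 ∧ Module.finrank ℝ Vm = 1 ∧
      Vp ⊓ Vm = ⊥ ∧ Vp ⊔ Vm = K ∧
      (∀ f ∈ Vp, f ≠ 0 → 0 < B f f) ∧
      (∀ f ∈ Vm, f ≠ 0 → B f f < 0) := by
  have hdne : ∀ k, d k ≠ 0 := by
    intro k
    refine Fin.cases h0.ne (fun i => (hd i).ne') k
  let A : (Fin 8 → ℝ) →ₗ[ℝ] (Fin 9 → ℝ) :=
    { toFun := fun v => Fin.cons 0 v
      map_add' := by intro u v; ext k; refine Fin.cases ?_ (fun i => ?_) k <;> simp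
      map_smul' := by intro u v; ext k; refine Fin.cases ?_ (fun i => ?_) k <;> simp }
  let C : ℝ →ₗ[ℝ] (Fin 9 → ℝ) :=
    { toFun := fun v => Fin.cons v 0
      map_add' := by intro u v; ext k; refine Fin.cases ?_ (fun i => ?_) k <;> simp
      map_smul' := by intro u v; ext k; refine Fin.cases ?_ (fun i => ?_) k <;> simp }
  have hA0 : ∀ v, A v 0 = 0 := fun v => rfl
  have hAs : ∀ v i, A v (Fin.succ i) = v i := fun v i => rfl
  have hC0 : ∀ v, C v 0 = v := fun v => rfl
  have hCs : ∀ v i, C v (Fin.succ i) = 0 := fun v i => rfl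
  have hAi : Function.Injective A := by
    intro u v h; ext i; rw [← hAs u, ← hAs v, h]
  have hCi : Function.Injective C := by
    intro u v h; rw [← hC0 u, ← hC0 v, h]
  let J : (Fin 9 → ℝ) →ₗ[ℝ] V := K.subtype ∘ₗ Φ.symm.toLinearMap
  have hJi : Function.Injective J := by
    intro u v h
    exact Φ.symm.injective (Subtype.ext h)
  have hJK : ∀ v, J v ∈ K := fun v => (Φ.symm v).2
  have hBJ : ∀ u v, B (J u) (J v) = ∑ k, d k * u k * v k := by
    intro u v
    have := hB (Φ.symm u) (Φ.symm v)
    simp only [LinearEquiv.apply_symm_apply] at this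
    exact this
  have hsurj : ∀ f ∈ K, ∃ v, f = J v := by
    intro f hf
    exact ⟨Φ ⟨f, hf⟩, by simp [J]⟩
  refine ⟨by simpa using Φ.finrank_eq, ?_, LinearMap.range (J ∘ₗ A), LinearMap.range (J ∘ₗ C),
    ?_, ?_, ?_, ?_, ?_, ?_, ?_, ?_⟩
  · intro f hf h
    obtain ⟨v, rfl⟩ := hsurj f hf
    have : v = 0 := by
      ext k
      have := h (J (Pi.single k 1)) (hJK _)
      rw [hBJ] at this
      simpa [Pi.single_apply, hdne] using this
    simp [this]
  · rintro _ ⟨v, rfl⟩; exact hJK _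
  · rintro _ ⟨v, rfl⟩; exact hJK _
  · rw [LinearMap.finrank_range_of_inj (show Function.Injective (J ∘ₗ A) from fun a b h => hAi (hJi h))]; simp
  · rw [LinearMap.finrank_range_of_inj (show Function.Injective (J ∘ₗ C) from fun a b h => hCi (hJi h))]; simp
  · rw [eq_bot_iff]
    rintro _ ⟨⟨u, rfl⟩, ⟨v, h⟩⟩
    have h1 : C v = A u := hJi h
    have h2 : v = 0 := by rw [← hC0 v, h1, hA0]
    rw [← h, h2]; simp
  · apply le_antisymm
    · apply sup_le
      · rintro _ ⟨v, rfl⟩; exact hJK _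
      · rintro _ ⟨v, rfl⟩; exact hJK _
    · intro f hf
      obtain ⟨v, rfl⟩ := hsurj f hf
      have : v = A (fun i => v i.succ) + C (v 0) := by
        ext k; refine Fin.cases ?_ (fun i => ?_) k
        · simp [hA0, hC0]
        · simp [hAs, hCs]
      rw [this, map_add]
      exact Submodule.add_mem_sup ⟨_, rfl⟩ ⟨_, rfl⟩
  · rintro _ ⟨v, rfl⟩ hne
    have hv : v ≠ 0 := by rintro rfl; simp at hne
    obtain ⟨i, hi⟩ := Function.ne_iff.mp hv
    simp only [LinearMap.comp_apply, hBJ]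
    rw [Fin.sum_univ_succ]
    simp only [hA0, hAs, mul_zero, zero_add, mul_assoc]
    refine Finset.sum_pos' (fun j _ => mul_nonneg (hd j).le (mul_self_nonneg _))
      ⟨i, Finset.mem_univ _, mul_pos (hd i) (mul_self_pos.mpr hi)⟩
  · rintro _ ⟨v, rfl⟩ hne
    have hv : v ≠ 0 := by rintro rfl; simp at hne
    simp only [LinearMap.comp_apply, hBJ]
    rw [Fin.sum_univ_succ]
    simp only [hC0, hCs, mul_zero, Finset.sum_const_zero, add_zero, mul_assoc]
    exact mul_neg_of_neg_of_pos h0 (mul_self_pos.mpr hv)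

noncomputable def ee (x : E3) : Fin 9 → ℝ :=
  ![1, x 0, x 1, x 2, x 0 * x 1, x 0 * x 2, x 1 * x 2, x 0 ^ 2 - x 1 ^ 2,
    2 * x 2 ^ 2 - x 0 ^ 2 - x 1 ^ 2]

noncomputable def dd (τ : ℝ) : Fin 9 → ℝ :=
  ![(2 - 2 * τ ^ 2 / 3) / 4, 1 / 2, 1 / 2, 1 / 2, τ ^ 2 / 2, τ ^ 2 / 2, τ ^ 2 / 2, τ ^ 2 / 8,
    τ ^ 2 / 24]

lemma sph {x : E3} (hx : x ∈ Sphere2) : x 0 ^ 2 + x 1 ^ 2 + x 2 ^ 2 = 1 := by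
  have h : ‖x‖ = 1 := by simpa [Sphere2] using hx
  have := EuclideanSpace.norm_sq_eq x
  rw [h, Fin.sum_univ_three] at this
  simpa using this.symm

lemma mem_sph {x : E3} (h : x 0 ^ 2 + x 1 ^ 2 + x 2 ^ 2 = 1) : x ∈ Sphere2 := by
  have := EuclideanSpace.norm_sq_eq x
  rw [Fin.sum_univ_three] at this
  simp only [Real.norm_eq_abs, sq_abs, h] at this
  have h1 : ‖x‖ = 1 := by
    have := norm_nonneg x
    nlinarith
  simpa [Sphere2] using h1

lemma inner3 (x y : E3) : ⟪x, y⟫ = x 0 * y 0 + x 1 * y 1 + x 2 * y 2 := by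
  rw [PiLp.inner_apply, Fin.sum_univ_three]
  simp [mul_comm]

lemma D_expand (τ : ℝ) {x y : E3} (hx : x ∈ Sphere2) (hy : y ∈ Sphere2) :
    Dfun τ x y = ∑ k, dd τ k * ee x k * ee y k := by
  have h1 := sph hx
  have h2 := sph hy
  simp only [Dfun, inner3, Fin.sum_univ_succ, dd, ee]
  simp
  linear_combination (τ ^ 2 / 12) * (y 0 ^ 2 + y 1 ^ 2 + y 2 ^ 2) * h1 + (τ ^ 2 / 12) * h2

lemma ee_cont (k : Fin 9) : Continuous fun x : E3 => ee x k := by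
  fin_cases k <;> simp [ee] <;> fun_prop

lemma ee_indep (c : Fin 9 → ℝ) (h : ∀ x ∈ Sphere2, ∑ k, c k * ee x k = 0) : c = 0 := by
  have H : ∀ a b d : ℝ, a ^ 2 + b ^ 2 + d ^ 2 = 1 →
      c 0 + c 1 * a + c 2 * b + c 3 * d + c 4 * (a * b) + c 5 * (a * d) + c 6 * (b * d)
      + c 7 * (a ^ 2 - b ^ 2) + c 8 * (2 * d ^ 2 - a ^ 2 - b ^ 2) = 0 := by
    intro a b d habd
    have := h !₂[a, b, d] (mem_sph (by simpa using habd))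
    simp only [Fin.sum_univ_succ, ee] at this
    simp at this
    linarith
  have a1 := H 1 0 0 (by norm_num)
  have a2 := H (-1) 0 0 (by norm_num)
  have a3 := H 0 1 0 (by norm_num)
  have a4 := H 0 (-1) 0 (by norm_num)
  have a5 := H 0 0 1 (by norm_num)
  have a6 := H 0 0 (-1) (by norm_num)
  have a7 := H (3/5) (4/5) 0 (by norm_num)
  have a8 := H (3/5) 0 (4/5) (by norm_num)
  have a9 := H 0 (3/5) (4/5) (by norm_num)
  ext k
  fin_cases k <;> simp <;> linarith

lemma sphere_param (p q : E3) (hp : p ∈ Sphere2) (hq : q ∈ Sphere2) :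
    ∃ v : E3, ∃ t : ℝ, (∀ s : ℝ, Real.cos s • p + Real.sin s • v ∈ Sphere2) ∧
      q = Real.cos t • p + Real.sin t • v := by
  have hp1 : ‖p‖ = 1 := by simpa [Sphere2] using hp
  have hq1 : ‖q‖ = 1 := by simpa [Sphere2] using hq
  have hpp : ⟪p, p⟫ = 1 := by rw [real_inner_self_eq_norm_sq, hp1]; norm_num
  have hqq : ⟪q, q⟫ = 1 := by rw [real_inner_self_eq_norm_sq, hq1]; norm_num
  have key : ∃ v : E3, ∃ b : ℝ, ‖v‖ = 1 ∧ ⟪p, v⟫ = 0 ∧ q = ⟪p, q⟫ • p + b • v := by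
    by_cases hw : q - ⟪p, q⟫ • p = 0
    · have : ∃ v : E3, v ≠ 0 ∧ ⟪p, v⟫ = 0 := by
        have : Fact (Module.finrank ℝ E3 = 2 + 1) := ⟨by simp⟩
        have hp0 : p ≠ 0 := by rintro rfl; simp at hp1
        have h2 := Submodule.finrank_orthogonal_span_singleton (𝕜 := ℝ) (n := 2) hp0
        have : Nontrivial (ℝ ∙ p)ᗮ := Module.nontrivial_of_finrank_pos (R := ℝ) (by omega)
        obtain ⟨v, hv⟩ := exists_ne (0 : (ℝ ∙ p)ᗮ)
        exact ⟨v, by simpa using hv, Submodule.mem_orthogonal_singleton_iff_inner_right.mp v.2⟩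
      obtain ⟨v, hv, hpv⟩ := this
      refine ⟨‖v‖⁻¹ • v, 0, ?_, ?_, ?_⟩
      · rw [norm_smul]; simp [hv]
      · rw [inner_smul_right, hpv, mul_zero]
      · simpa using sub_eq_zero.mp hw
    · set w := q - ⟪p, q⟫ • p with hwd
      refine ⟨‖w‖⁻¹ • w, ‖w‖, ?_, ?_, ?_⟩
      · rw [norm_smul]; simp [hw]
      · rw [inner_smul_right, hwd, inner_sub_right, inner_smul_right, hpp]; simp
      · rw [smul_smul, mul_inv_cancel₀ (norm_ne_zero_iff.mpr hw), one_smul, hwd]; abel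
  obtain ⟨v, b, hv, hpv, hqe⟩ := key
  have hvv : ⟪v, v⟫ = 1 := by rw [real_inner_self_eq_norm_sq, hv]; norm_num
  have hvp : ⟪v, p⟫ = 0 := by rw [real_inner_comm]; exact hpv
  have hexp : ∀ a b : ℝ, ⟪a • p + b • v, a • p + b • v⟫ = a ^ 2 + b ^ 2 := by
    intro a b
    simp only [inner_add_left, inner_add_right, real_inner_smul_left, real_inner_smul_right,
      hpp, hvv, hpv, hvp]
    ring
  have hab : ⟪p, q⟫ ^ 2 + b ^ 2 = 1 := by
    rw [← hexp, ← hqe, hqq]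
  refine ⟨v, Complex.arg ⟨⟪p, q⟫, b⟩, ?_, ?_⟩
  · intro s
    have h1 := hexp (Real.cos s) (Real.sin s)
    rw [Real.cos_sq_add_sin_sq, real_inner_self_eq_norm_sq] at h1
    have : ‖Real.cos s • p + Real.sin s • v‖ = 1 := by
      have := norm_nonneg (Real.cos s • p + Real.sin s • v)
      nlinarith
    simpa [Sphere2] using this
  · have hn : ‖(⟨⟪p, q⟫, b⟩ : ℂ)‖ = 1 := by
      rw [Complex.norm_def, Complex.normSq_mk, ← sq, ← sq, hab, Real.sqrt_one]
    have hne : (⟨⟪p, q⟫, b⟩ : ℂ) ≠ 0 := by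
      intro h; rw [h] at hn; simp at hn
    rw [Complex.cos_arg hne, Complex.sin_arg, hn]
    simpa using hqe

lemma ee_indep_local (U : Set E3) (hU : IsOpen U) (hne : (U ∩ Sphere2).Nonempty)
    (c : Fin 9 → ℝ) (h : ∀ x ∈ U ∩ Sphere2, ∑ k, c k * ee x k = 0) : c = 0 := by
  obtain ⟨p, hpU, hpS⟩ := hne
  apply ee_indep
  intro q hq
  obtain ⟨v, t, hv, rfl⟩ := sphere_param p q hpS hq
  let F : ℝ → ℝ := fun s => ∑ k, c k * ee (Real.cos s • p + Real.sin s • v) k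
  have han : AnalyticOnNhd ℝ F univ := by
    intro s _
    apply Finset.analyticAt_fun_sum
    intro k _
    have hco : ∀ i, AnalyticAt ℝ (fun s => Real.cos s * p i + Real.sin s * v i) s := by
      intro i; fun_prop
    refine analyticAt_const.mul ?_
    have h0 := hco 0
    have h1 := hco 1
    have h2 := hco 2
    fin_cases k <;> simp [ee] <;> fun_prop
  have hz : F =ᶠ[nhds 0] 0 := by
    have hc : Continuous fun s : ℝ => Real.cos s • p + Real.sin s • v := by fun_prop
    have : ∀ᶠ s in nhds (0:ℝ), Real.cos s • p + Real.sin s • v ∈ U := by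
      apply hc.continuousAt.eventually_mem
      apply hU.mem_nhds
      simpa using hpU
    filter_upwards [this] with s hs
    exact h _ ⟨hs, hv s⟩
  have := han.eqOn_zero_of_preconnected_of_eventuallyEq_zero isPreconnected_univ
    (mem_univ 0) hz (mem_univ t)
  exact this

lemma sphere_finite : (μH[2] : Measure E3) Sphere2 < ⊤ := by
  let S : ℝ × ℝ → E3 := fun z =>
    !₂[Real.cos z.1 * Real.cos z.2, Real.cos z.1 * Real.sin z.2, Real.sin z.1]
  have hS : ContDiff ℝ 1 S := by
    rw [contDiff_euclidean]
    intro i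
    fin_cases i <;> simp [S] <;> fun_prop
  let R : Set (ℝ × ℝ) := Icc (-Real.pi) Real.pi ×ˢ Icc (-Real.pi) Real.pi
  have hRc : IsCompact R := isCompact_Icc.prod isCompact_Icc
  obtain ⟨C, hC⟩ := hS.contDiffOn.exists_lipschitzOnWith one_ne_zero
    ((convex_Icc (-Real.pi) Real.pi).prod (convex_Icc (-Real.pi) Real.pi)) hRc
  have h1 := hC.hausdorffMeasure_image_le (d := 2) (by norm_num)
  have hsub : Sphere2 ⊆ S '' R := by
    intro x hx
    have hx := sph hx
    have hpi := Real.pi_pos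
    have hn : ‖(⟨x 0, x 1⟩ : ℂ)‖ = Real.sqrt (1 - x 2 ^ 2) := by
      rw [Complex.norm_def, Complex.normSq_mk]
      congr 1; linarith
    refine ⟨(Real.arcsin (x 2), Complex.arg ⟨x 0, x 1⟩), ⟨⟨?_, ?_⟩, ?_, ?_⟩, ?_⟩
    · have := Real.neg_pi_div_two_le_arcsin (x 2); simp only; linarith
    · have := Real.arcsin_le_pi_div_two (x 2); simp only; linarith
    · exact (Complex.neg_pi_lt_arg _).le
    · exact Complex.arg_le_pi _
    · ext i
      fin_cases i
      · simp only [S, Real.cos_arcsin, ← hn]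
        exact Complex.norm_mul_cos_arg _
      · simp only [S, Real.cos_arcsin, ← hn]
        exact Complex.norm_mul_sin_arg _
      · simp only [S]
        exact Real.sin_arcsin (by nlinarith [sq_nonneg (x 0), sq_nonneg (x 1)])
          (by nlinarith [sq_nonneg (x 0), sq_nonneg (x 1)])
  refine (measure_mono hsub).trans_lt (h1.trans_lt ?_)
  rw [hausdorffMeasure_prod_real]
  exact ENNReal.mul_lt_top (by simp) hRc.measure_lt_top

lemma sphere_pos (U : Set E3) (hU : IsOpen U) (hne : (U ∩ Sphere2).Nonempty) :
    (μH[2] : Measure E3) (U ∩ Sphere2) ≠ 0 := by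
  obtain ⟨p, hpU, hpS⟩ := hne
  have hp1 := sph hpS
  obtain ⟨k, hk⟩ : ∃ k, p k ≠ 0 := by
    by_contra! h
    simp [h] at hp1
  let T : E3 → (Fin 2 → ℝ) := fun x i => x (k.succAbove i)
  have hT : LipschitzWith 1 T := by
    apply LipschitzWith.of_dist_le_mul
    intro x y
    rw [NNReal.coe_one, one_mul, dist_pi_le_iff dist_nonneg]
    intro i
    rw [EuclideanSpace.dist_eq]
    apply Real.le_sqrt_of_sq_le
    exact Finset.single_le_sum (f := fun j => dist (x j) (y j) ^ 2)
      (fun j _ => sq_nonneg _) (Finset.mem_univ (k.succAbove i))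
  let σ : ℝ := SignType.sign (p k)
  have hσ : σ * σ = 1 := by
    rcases lt_or_gt_of_ne hk with h | h <;> simp [σ, h]
  let s : (Fin 2 → ℝ) → E3 := fun w =>
    WithLp.toLp 2 (k.insertNth (σ * Real.sqrt (1 - (w 0 ^ 2 + w 1 ^ 2))) w : Fin 3 → ℝ)
  have hsk : ∀ w, s w k = σ * Real.sqrt (1 - (w 0 ^ 2 + w 1 ^ 2)) := by intro w; simp [s]
  have hss : ∀ w i, s w (k.succAbove i) = w i := by intro w i; simp [s]
  have hsum : ∀ x : E3, x 0 ^ 2 + x 1 ^ 2 + x 2 ^ 2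
      = x k ^ 2 + (x (k.succAbove 0) ^ 2 + x (k.succAbove 1) ^ 2) := by
    intro x
    have := Fin.sum_univ_succAbove (fun i => x i ^ 2) k
    rw [Fin.sum_univ_three, Fin.sum_univ_two] at this
    exact this
  have hsc : Continuous s := by
    refine (PiLp.continuous_toLp 2 _).comp ?_
    refine Continuous.finInsertNth (A := fun _ => ℝ) k ?_ continuous_id
    fun_prop
  let W : Set (Fin 2 → ℝ) := s ⁻¹' U ∩ {w | w 0 ^ 2 + w 1 ^ 2 < 1}
  have hW : IsOpen W := (hU.preimage hsc).inter (isOpen_lt (by fun_prop) (by fun_prop))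
  have hsp : s (T p) = p := by
    ext j
    rcases Fin.eq_self_or_eq_succAbove k j with rfl | ⟨i, rfl⟩
    · rw [hsk]
      have h2 := hsum p
      rw [hp1] at h2
      have : 1 - (T p 0 ^ 2 + T p 1 ^ 2) = p j ^ 2 := by simp only [T]; linarith
      rw [this, Real.sqrt_sq_eq_abs]
      exact sign_mul_abs _
    · rw [hss]
  have hWne : W.Nonempty := by
    refine ⟨T p, ?_, ?_⟩
    · simpa [hsp] using hpU
    · have h2 := hsum p
      rw [hp1] at h2
      have : 0 < p k ^ 2 := by positivity
      simp only [mem_ofPred_eq, T]; linarith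
  have hWT : W ⊆ T '' (U ∩ Sphere2) := by
    rintro w ⟨hw1, hw2⟩
    refine ⟨s w, ⟨hw1, mem_sph ?_⟩, ?_⟩
    · rw [hsum, hsk, hss, hss, mul_pow, Real.sq_sqrt (by simp at hw2; linarith), sq, hσ]; ring
    · ext i; exact hss w i
  have h3 := hT.hausdorffMeasure_image_le (d := 2) (by norm_num) (U ∩ Sphere2)
  have h4 : (μH[2] : Measure (Fin 2 → ℝ)) = volume := by
    have := hausdorffMeasure_pi_real (ι := Fin 2)
    simpa using this
  intro h0
  rw [h0, mul_zero, h4] at h3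
  have h5 := hW.measure_pos volume hWne
  have := measure_mono (μ := volume) hWT
  exact absurd (this.trans h3) (not_le.mpr h5)

lemma K_eq (Ω : Set E3) (hS : Ω ⊆ Sphere2) :
    KSpace Ω = Submodule.span ℝ (range fun (k : Fin 9) (x : Ω) => ee x k) := by
  apply le_antisymm
  · apply Submodule.span_le.mpr
    rintro f ⟨P, hP, hf⟩
    set S := Submodule.span ℝ (range fun (k : Fin 9) (x : Ω) => ee x k) with hSd
    have hmem : ∀ k : Fin 9, (fun x : Ω => ee x k) ∈ S := fun k =>
      Submodule.subset_span ⟨k, rfl⟩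
    have hcomb : ∀ c : Fin 9 → ℝ, (fun x : Ω => ∑ k, c k * ee x k) ∈ S := by
      intro c
      have : (fun x : Ω => ∑ k, c k * ee x k) = ∑ k, c k • (fun x : Ω => ee x k) := by
        ext x; simp
      rw [this]
      exact Submodule.sum_mem _ fun k _ => Submodule.smul_mem _ _ (hmem k)
    have hmon : ∀ a b c : ℕ, a + b + c ≤ 2 →
        (fun x : Ω => (x : E3) 0 ^ a * (x : E3) 1 ^ b * (x : E3) 2 ^ c) ∈ S := by
      intro a b c habc
      have hf : ∀ c : Fin 9 → ℝ, ∀ f : Ω → ℝ, (∀ x : Ω, f x = ∑ k, c k * ee x k) → f ∈ S := by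
        intro c f h
        rw [funext h]; exact hcomb c
      have ha : a ≤ 2 := by omega
      have hb : b ≤ 2 := by omega
      have hc : c ≤ 2 := by omega
      interval_cases a <;> interval_cases b <;> interval_cases c <;> (try omega)
      · refine hf ![1,0,0,0,0,0,0,0,0] _ fun x => ?_
        simp [ee, Fin.sum_univ_succ]
      · refine hf ![0,0,0,1,0,0,0,0,0] _ fun x => ?_
        simp [ee, Fin.sum_univ_succ]
      · refine hf ![1/3,0,0,0,0,0,0,0,1/3] _ fun x => ?_
        have := sph (hS x.2)
        simp [ee, Fin.sum_univ_succ]; linarith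
      · refine hf ![0,0,1,0,0,0,0,0,0] _ fun x => ?_
        simp [ee, Fin.sum_univ_succ]
      · refine hf ![0,0,0,0,0,0,1,0,0] _ fun x => ?_
        simp [ee, Fin.sum_univ_succ]
      · refine hf ![1/3,0,0,0,0,0,0,-1/2,-1/6] _ fun x => ?_
        have := sph (hS x.2)
        simp [ee, Fin.sum_univ_succ]; linarith
      · refine hf ![0,1,0,0,0,0,0,0,0] _ fun x => ?_
        simp [ee, Fin.sum_univ_succ]
      · refine hf ![0,0,0,0,0,1,0,0,0] _ fun x => ?_
        simp [ee, Fin.sum_univ_succ]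
      · refine hf ![0,0,0,0,1,0,0,0,0] _ fun x => ?_
        simp [ee, Fin.sum_univ_succ]
      · refine hf ![1/3,0,0,0,0,0,0,1/2,-1/6] _ fun x => ?_
        have := sph (hS x.2)
        simp [ee, Fin.sum_univ_succ]; linarith
    have : f = ∑ m ∈ P.support, P.coeff m •
        (fun x : Ω => (x : E3) 0 ^ m 0 * (x : E3) 1 ^ m 1 * (x : E3) 2 ^ m 2) := by
      ext x
      rw [hf, MvPolynomial.eval_eq']
      simp [Fin.prod_univ_three]
    rw [this]
    refine Submodule.sum_mem _ fun m hm => Submodule.smul_mem _ _ (hmon _ _ _ ?_)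
    have := (MvPolynomial.le_totalDegree hm).trans hP
    rw [Finsupp.sum_fintype _ _ (by simp), Fin.sum_univ_three] at this
    exact this
  · apply Submodule.span_mono
    rintro _ ⟨k, rfl⟩
    have hX : ∀ i : Fin 3, (MvPolynomial.X i : MvPolynomial (Fin 3) ℝ).totalDegree = 1 :=
      fun i => MvPolynomial.totalDegree_X i
    have hXX : ∀ i j : Fin 3,
        (MvPolynomial.X i * MvPolynomial.X j : MvPolynomial (Fin 3) ℝ).totalDegree ≤ 2 :=
      fun i j => (MvPolynomial.totalDegree_mul _ _).trans (by rw [hX, hX])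
    have hsub : ∀ p q : MvPolynomial (Fin 3) ℝ, p.totalDegree ≤ 2 → q.totalDegree ≤ 2 →
        (p - q).totalDegree ≤ 2 := fun p q hp hq =>
      (MvPolynomial.totalDegree_sub p q).trans (max_le hp hq)
    open MvPolynomial in
    fin_cases k
    · exact ⟨1, by simp, fun x => by simp [ee]⟩
    · exact ⟨X 0, by simp, fun x => by simp [ee]⟩
    · exact ⟨X 1, by simp, fun x => by simp [ee]⟩
    · exact ⟨X 2, by simp, fun x => by simp [ee]⟩
    · exact ⟨X 0 * X 1, hXX _ _, fun x => by simp [ee]⟩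
    · exact ⟨X 0 * X 2, hXX _ _, fun x => by simp [ee]⟩
    · exact ⟨X 1 * X 2, hXX _ _, fun x => by simp [ee]⟩
    · exact ⟨X 0 * X 0 - X 1 * X 1, hsub _ _ (hXX _ _) (hXX _ _),
        fun x => by simp [ee]; ring⟩
    · exact ⟨(X 2 * X 2 - X 0 * X 0) - (X 1 * X 1 - X 2 * X 2),
        hsub _ _ (hsub _ _ (hXX _ _) (hXX _ _)) (hsub _ _ (hXX _ _) (hXX _ _)),
        fun x => by simp [ee]; ring⟩

lemma surf_finite (Ω : Set E3) (hm : MeasurableSet Ω) (hS : Ω ⊆ Sphere2) :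
    IsFiniteMeasure (surfΩ Ω) := by
  constructor
  rw [surfΩ, (MeasurableEmbedding.subtype_coe hm).comap_apply]
  refine (measure_mono ?_).trans_lt sphere_finite
  rintro _ ⟨x, _, rfl⟩
  exact hS x.2

lemma surf_open (U Ω : Set E3) (hU : IsOpen U) (hΩ : Ω = U ∩ Sphere2) (hm : MeasurableSet Ω) :
    (surfΩ Ω).IsOpenPosMeasure := by
  constructor
  intro V hV hne
  rw [surfΩ, (MeasurableEmbedding.subtype_coe hm).comap_apply]
  obtain ⟨W, hW, rfl⟩ := isOpen_induced_iff.mp hV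
  have : Subtype.val '' (Subtype.val ⁻¹' W : Set Ω) = (W ∩ U) ∩ Sphere2 := by
    rw [Subtype.image_preimage_coe, hΩ]
    ext x; simp only [mem_inter_iff]; tauto
  rw [this]
  apply sphere_pos _ (hW.inter hU)
  rw [← this]
  exact hne.image _

lemma surf_int (Ω : Set E3) (hm : MeasurableSet Ω) (hS : Ω ⊆ Sphere2) (h : E3 → ℝ)
    (hc : Continuous h) : Integrable (fun x : Ω => h x) (surfΩ Ω) := by
  have := surf_finite Ω hm hS
  obtain ⟨C, hC⟩ := (isCompact_sphere (0 : E3) 1).exists_bound_of_continuousOn hc.continuousOn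
  refine Integrable.of_bound (hc.comp continuous_subtype_val).aestronglyMeasurable C ?_
  exact Filter.Eventually.of_forall fun x => hC _ (hS x.2)

/-- Lemma 4.2: for `τ > √3` and a nonempty open totally timelike `Ω`,
the space `K(Ω)` is nine-dimensional and the bilinear form `B` is nondegenerate of
signature `(8,1)`. -/
theorem stmt_4 (τ : ℝ) (hτ : Real.sqrt 3 < τ) (Ω : Set E3) (hne : Ω.Nonempty)
    (hopen : ∃ U : Set E3, IsOpen U ∧ Ω = U ∩ Sphere2) (htt : TotallyTimelike τ Ω) :
    Module.finrank ℝ (KSpace Ω) = 9 ∧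
    (∀ f ∈ KSpace Ω, (∀ g ∈ KSpace Ω, Bform τ Ω f g = 0) → f = 0) ∧
    ∃ Vp Vm : Submodule ℝ (Ω → ℝ),
      Vp ≤ KSpace Ω ∧ Vm ≤ KSpace Ω ∧
      Module.finrank ℝ Vp = 8 ∧ Module.finrank ℝ Vm = 1 ∧
      Vp ⊓ Vm = ⊥ ∧ Vp ⊔ Vm = KSpace Ω ∧
      (∀ f ∈ Vp, f ≠ 0 → 0 < Bform τ Ω f f) ∧
      (∀ f ∈ Vm, f ≠ 0 → Bform τ Ω f f < 0) := by
  obtain ⟨U, hU, hΩ⟩ := hopen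
  have hS : Ω ⊆ Sphere2 := by rw [hΩ]; exact inter_subset_right
  have hm : MeasurableSet Ω := by
    rw [hΩ]; exact hU.measurableSet.inter Metric.isClosed_sphere.measurableSet
  have := surf_finite Ω hm hS
  have := surf_open U Ω hU hΩ hm
  have hK := K_eq Ω hS
  have hext : ∀ f ∈ KSpace Ω, ∃ c : Fin 9 → ℝ, f = fun x : Ω => ∑ k, c k * ee x k := by
    intro f hf
    rw [hK, Submodule.mem_span_range_iff_exists_fun] at hf
    obtain ⟨c, rfl⟩ := hf
    exact ⟨c, by ext x; simp⟩
  have hcont : ∀ c : Fin 9 → ℝ, Continuous fun x : E3 => ∑ k, c k * ee x k := fun c =>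
    continuous_finsetSum _ fun k _ => continuous_const.mul (ee_cont k)
  have hint : ∀ f ∈ KSpace Ω, ∀ k, Integrable (fun x : Ω => ee x k * f x) (surfΩ Ω) := by
    intro f hf k
    obtain ⟨c, rfl⟩ := hext f hf
    exact surf_int Ω hm hS (fun x => ee x k * ∑ j, c j * ee x j) ((ee_cont k).mul (hcont c))
  let M : KSpace Ω →ₗ[ℝ] (Fin 9 → ℝ) :=
    { toFun := fun f k => ∫ x, ee x k * f.1 x ∂(surfΩ Ω)
      map_add' := by
        intro f g; ext k
        simp only [Submodule.coe_add, Pi.add_apply, mul_add]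
        exact integral_add (hint f f.2 k) (hint g g.2 k)
      map_smul' := by
        intro a f; ext k
        simp only [Submodule.coe_smul, Pi.smul_apply, smul_eq_mul, RingHom.id_apply]
        rw [← integral_const_mul]
        congr 1; ext x; ring }
  have hM : ∀ f k, M f k = ∫ x, ee x k * f.1 x ∂(surfΩ Ω) := fun f k => rfl
  have hinj : Function.Injective M := by
    rw [← LinearMap.ker_eq_bot, LinearMap.ker_eq_bot']
    intro f hf
    obtain ⟨c, hc⟩ := hext f f.2
    have h0 : ∫ x, f.1 x * f.1 x ∂(surfΩ Ω) = 0 := by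
      have : ∀ x, f.1 x * f.1 x = ∑ k, c k * (ee (x : E3) k * f.1 x) := by
        intro x
        conv_lhs => enter [1]; rw [hc]
        rw [Finset.sum_mul]
        simp only [mul_assoc]
      simp only [this]
      rw [integral_finsetSum _ fun k _ => (hint f f.2 k).const_mul _]
      apply Finset.sum_eq_zero
      intro k _
      rw [integral_const_mul, ← hM, hf]; simp
    have hfc : Continuous f.1 := by rw [hc]; exact (hcont c).comp continuous_subtype_val
    have hfi : Integrable (fun x => f.1 x * f.1 x) (surfΩ Ω) := by
      rw [hc]
      exact surf_int Ω hm hS (fun x => (∑ j, c j * ee x j) * ∑ j, c j * ee x j)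
        ((hcont c).mul (hcont c))
    rw [integral_eq_zero_iff_of_nonneg (fun x => mul_self_nonneg _) hfi] at h0
    have h1 := ((hfc.mul hfc).ae_eq_iff_eq (surfΩ Ω) continuous_const).mp h0
    apply Subtype.ext
    ext x
    exact mul_self_eq_zero.mp (congrFun h1 x)
  have hli : LinearIndependent ℝ (fun (k : Fin 9) (x : Ω) => ee x k) := by
    rw [Fintype.linearIndependent_iff]
    intro c hc k
    have : c = 0 := by
      apply ee_indep_local U hU (hΩ ▸ hne)
      intro x hx
      have := congrFun hc ⟨x, hΩ ▸ hx⟩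
      simpa using this
    rw [this]; rfl
  have hfr : Module.finrank ℝ (KSpace Ω) = 9 := by
    rw [hK, finrank_span_eq_card hli]; simp
  have : FiniteDimensional ℝ (KSpace Ω) := Module.finite_of_finrank_pos (by omega)
  let Φ := LinearMap.linearEquivOfInjective M hinj (by rw [hfr]; simp)
  have hΦ : ∀ f k, Φ f k = ∫ x, ee x k * f.1 x ∂(surfΩ Ω) := fun f k => rfl
  have hτ2 : 3 < τ ^ 2 := by
    have h3 := Real.sqrt_nonneg 3
    have := Real.sq_sqrt (show (0:ℝ) ≤ 3 by norm_num)
    nlinarith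
  refine absLin (KSpace Ω) Φ (Bform τ Ω) (dd τ) ?_ ?_ ?_
  · simp [dd]; linarith
  · intro k
    fin_cases k <;> simp [dd] <;> nlinarith
  · intro f g
    have hin : ∀ x : Ω, ∫ y : Ω, Dfun τ x y * f.1 x * g.1 y ∂(surfΩ Ω)
        = ∑ k, (dd τ k * Φ g k) * (ee x k * f.1 x) := by
      intro x
      have : ∀ y : Ω, Dfun τ x y * f.1 x * g.1 y
          = ∑ k, (dd τ k * ee x k * f.1 x) * (ee y k * g.1 y) := by
        intro y
        rw [D_expand τ (hS x.2) (hS y.2), Finset.sum_mul, Finset.sum_mul]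
        refine Finset.sum_congr rfl fun k _ => by ring
      simp only [this]
      rw [integral_finsetSum _ fun k _ => (hint g g.2 k).const_mul _]
      refine Finset.sum_congr rfl fun k _ => ?_
      rw [integral_const_mul, ← hΦ]; ring
    unfold Bform
    simp only [hin]
    rw [integral_finsetSum _ fun k _ => (hint f f.2 k).const_mul _]
    refine Finset.sum_congr rfl fun k _ => ?_
    rw [integral_const_mul, ← hΦ]; ring
end

section
/- Let τ > √3, let ρ_min be a minimizing measure, let Ω ⊆ S² be a nonempty open totally timelike set, let ρ be the restriction of ρ_min to Ω, and let μ be the two-dimensional Hausdorff (surface) measure on S² restricted to Ω. For a bounded measurable function ψ : Ω → ℝ define g(x) = ∫_Ω D(x,y) ψ(y) dρ(y) for x ∈ Ω. Then for every h ∈ K(Ω) satisfying ∫_Ω D(x,y) h(y) dμ(y) = g(x) for all x ∈ Ω, one has ∫_Ω h(x) g(x) dμ(x) ≥ 0. -/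
open MeasureTheory Set
open scoped RealInnerProductSpace ENNReal

lemma aux_sphere_meas : MeasurableSet Sphere2 := Metric.isClosed_sphere.measurableSet

lemma aux_inner_le {x y : E3} (hx : x ∈ Sphere2) (hy : y ∈ Sphere2) : |⟪x, y⟫| ≤ 1 := by
  have hx' : ‖x‖ = 1 := by simpa [Sphere2] using hx
  have hy' : ‖y‖ = 1 := by simpa [Sphere2] using hy
  have := abs_real_inner_le_norm x y
  simpa [hx', hy'] using this

lemma aux_D_le (τ : ℝ) {x y : E3} (hx : x ∈ Sphere2) (hy : y ∈ Sphere2) :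
    |Dfun τ x y| ≤ 1 + τ ^ 2 := by
  have h := abs_le.1 (aux_inner_le hx hy)
  unfold Dfun
  have h2 := sq_nonneg τ
  have a1 : |1 + ⟪x, y⟫| ≤ 2 := abs_le.2 ⟨by linarith [h.1], by linarith [h.2]⟩
  have a2 : |2 - τ ^ 2 * (1 - ⟪x, y⟫)| ≤ 2 + 2 * τ ^ 2 :=
    abs_le.2 ⟨by nlinarith [h.1], by nlinarith [h.2]⟩
  rw [abs_mul, abs_mul]
  have : |(1 / 4 : ℝ)| = 1 / 4 := by norm_num
  rw [this]
  have := mul_le_mul a1 a2 (abs_nonneg _) (by norm_num)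
  linarith

lemma aux_L_le (τ : ℝ) {x y : E3} (hx : x ∈ Sphere2) (hy : y ∈ Sphere2) :
    |Lfun τ x y| ≤ 1 + τ ^ 2 := by
  have h := abs_le.1 (aux_D_le τ hx hy)
  unfold Lfun
  rw [abs_of_nonneg (le_max_left _ _)]
  exact max_le (by positivity) h.2

lemma aux_D_symm (τ : ℝ) (x y : E3) : Dfun τ x y = Dfun τ y x := by
  unfold Dfun; rw [real_inner_comm]

lemma aux_D_cont (τ : ℝ) : Continuous (fun p : E3 × E3 => Dfun τ p.1 p.2) := by
  unfold Dfun; fun_prop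

lemma aux_L_cont (τ : ℝ) : Continuous (fun p : E3 × E3 => Lfun τ p.1 p.2) := by
  unfold Lfun; exact continuous_const.max (aux_D_cont τ)

lemma aux_int_s5 (τ : ℝ) (ρ : Measure E3) [IsFiniteMeasure ρ] (hs : ρ Sphere2ᶜ = 0)
    (u v : E3 → ℝ) (hu : Measurable u) (hv : Measurable v) (C : ℝ)
    (huC : ∀ x, |u x| ≤ C) (hvC : ∀ x, |v x| ≤ C) :
    Integrable (fun p : E3 × E3 => u p.1 * (v p.2 * Lfun τ p.1 p.2)) (ρ.prod ρ) := by
  have hL := (aux_L_cont τ).measurable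
  have hae : ∀ᵐ x ∂ρ, x ∈ Sphere2 := by
    rw [ae_iff]; exact hs
  have h1 : ∀ᵐ p ∂(ρ.prod ρ), p.1 ∈ Sphere2 := Measure.quasiMeasurePreserving_fst.ae hae
  have h2 : ∀ᵐ p ∂(ρ.prod ρ), p.2 ∈ Sphere2 := Measure.quasiMeasurePreserving_snd.ae hae
  refine Integrable.of_bound ?_ (C * (C * (1 + τ ^ 2))) ?_
  · exact ((hu.comp measurable_fst).mul ((hv.comp measurable_snd).mul hL)).aestronglyMeasurable
  · filter_upwards [h1, h2] with p hp1 hp2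
    have hC : 0 ≤ C := (abs_nonneg _).trans (huC p.1)
    rw [Real.norm_eq_abs, abs_mul, abs_mul]
    exact mul_le_mul (huC _) (mul_le_mul (hvC _) (aux_L_le τ hp1 hp2) (abs_nonneg _) hC)
      (by positivity) hC

lemma aux_weight (τ : ℝ) (ρ : Measure E3) (hmin : IsMinimizer τ ρ) (w : E3 → ℝ)
    (hw : Measurable w) (hw1 : ∀ x, 1 / 2 ≤ w x) (hw2 : ∀ x, w x ≤ 2) :
    causalAction τ ρ * (∫ x, w x ∂ρ) ^ 2 ≤
      ∫ p : E3 × E3, w p.1 * (w p.2 * Lfun τ p.1 p.2) ∂(ρ.prod ρ) := by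
  obtain ⟨hp, hr, hs, hm⟩ := hmin
  have hwi : Integrable w ρ := Integrable.of_bound hw.aestronglyMeasurable 2
    (Filter.Eventually.of_forall fun x => by
      rw [Real.norm_eq_abs, abs_le]; constructor <;> linarith [hw1 x, hw2 x])
  set c := ∫ x, w x ∂ρ with hc
  have hcpos : 0 < c := by
    have : ∫ x, (1 / 2 : ℝ) ∂ρ ≤ c := integral_mono (integrable_const _) hwi hw1
    simp at this
    linarith
  have hfm : Measurable (fun x => Real.toNNReal (w x / c)) := (hw.div_const c).real_toNNReal
  set ρ' : Measure E3 := ρ.withDensity (fun x => ((Real.toNNReal (w x / c) : NNReal) : ℝ≥0∞)) with hρ'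
  have hprob : IsProbabilityMeasure ρ' := by
    constructor
    rw [hρ', withDensity_apply _ MeasurableSet.univ, Measure.restrict_univ]
    have := ofReal_integral_eq_lintegral_ofReal (hwi.div_const c)
      (Filter.Eventually.of_forall fun x => div_nonneg (by linarith [hw1 x]) hcpos.le)
    change ∫⁻ x, ENNReal.ofReal (w x / c) ∂ρ = 1
    rw [← this, integral_div, ← hc, div_self hcpos.ne']
    simp
  have h0 : ρ' Sphere2ᶜ = 0 := withDensity_absolutelyContinuous ρ _ hs
  have key := hm ρ' hprob inferInstance h0
  have hI := aux_int_s5 τ ρ hs w w hw hw 2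
    (fun x => by rw [abs_le]; constructor <;> linarith [hw1 x, hw2 x])
    (fun x => by rw [abs_le]; constructor <;> linarith [hw1 x, hw2 x])
  have heq : causalAction τ ρ' =
      (∫ p : E3 × E3, w p.1 * (w p.2 * Lfun τ p.1 p.2) ∂(ρ.prod ρ)) / c ^ 2 := by
    unfold causalAction
    rw [hρ', integral_withDensity_eq_integral_smul hfm, integral_prod _ hI, ← integral_div]
    refine integral_congr_ae (Filter.Eventually.of_forall fun x => ?_)
    dsimp only
    rw [integral_withDensity_eq_integral_smul hfm]
    have hn : ∀ x, 0 ≤ w x / c := fun x => div_nonneg (by linarith [hw1 x]) hcpos.le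
    simp only [NNReal.smul_def, Real.coe_toNNReal _ (hn _), smul_eq_mul]
    rw [← integral_const_mul, ← integral_div]
    refine integral_congr_ae (Filter.Eventually.of_forall fun y => ?_)
    dsimp only
    field_simp
  rw [heq, le_div_iff₀ (by positivity)] at key
  exact key

lemma aux_Q (τ : ℝ) (ρ : Measure E3) (hmin : IsMinimizer τ ρ) (u : E3 → ℝ)
    (hu : Measurable u) (C : ℝ) (huC : ∀ x, |u x| ≤ C) :
    0 ≤ ∫ x, u x * ∫ y, u y * Lfun τ x y ∂ρ ∂ρ := by
  have hmin' := hmin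
  obtain ⟨hp, hr, hs, hm⟩ := hmin
  have hC : 0 ≤ C := (abs_nonneg _).trans (huC 0)
  set ε : ℝ := 1 / (2 * (C + 1)) with hε
  have hεpos : 0 < ε := by positivity
  have hεC : ε * C ≤ 1 / 2 := by
    rw [hε, div_mul_eq_mul_div, div_le_div_iff₀ (by positivity) (by norm_num)]; linarith
  have hb : ∀ x, |ε * u x| ≤ 1 / 2 := fun x => by
    rw [abs_mul, abs_of_pos hεpos]
    exact (mul_le_mul_of_nonneg_left (huC x) hεpos.le).trans hεC
  have hui : Integrable u ρ := Integrable.of_bound hu.aestronglyMeasurable C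
    (Filter.Eventually.of_forall huC)
  have hP := aux_weight τ ρ hmin' (fun x => 1 + ε * u x) (by fun_prop)
    (fun x => by have := abs_le.1 (hb x); linarith) (fun x => by have := abs_le.1 (hb x); linarith)
  have hN := aux_weight τ ρ hmin' (fun x => 1 - ε * u x) (by fun_prop)
    (fun x => by have := abs_le.1 (hb x); linarith) (fun x => by have := abs_le.1 (hb x); linarith)
  have h1C : ∀ x : E3, |(1 : ℝ)| ≤ C + 1 := fun x => by rw [abs_one]; linarith
  have huC' : ∀ x, |u x| ≤ C + 1 := fun x => by linarith [huC x]
  have I11 := aux_int_s5 τ ρ hs (fun _ => 1) (fun _ => 1) measurable_const measurable_const _ h1C h1C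
  have I1u := aux_int_s5 τ ρ hs (fun _ => 1) u measurable_const hu _ h1C huC'
  have Iu1 := aux_int_s5 τ ρ hs u (fun _ => 1) hu measurable_const _ huC' h1C
  have Iuu := aux_int_s5 τ ρ hs u u hu hu _ huC' huC'
  have hQ := integral_prod _ Iuu
  have hS := integral_prod _ I11
  simp only [one_mul] at hS
  have hS0 : 0 ≤ causalAction τ ρ := by
    unfold causalAction
    exact integral_nonneg fun x => integral_nonneg fun y => le_max_left _ _
  have eP : (∫ x, (1 + ε * u x) ∂ρ) = 1 + ε * ∫ x, u x ∂ρ := by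
    rw [integral_add (integrable_const _) (hui.const_mul ε), integral_const_mul]; simp
  have eN : (∫ x, (1 - ε * u x) ∂ρ) = 1 - ε * ∫ x, u x ∂ρ := by
    rw [integral_sub (integrable_const _) (hui.const_mul ε), integral_const_mul]; simp
  have IP := aux_int_s5 τ ρ hs (fun x => 1 + ε * u x) (fun x => 1 + ε * u x) (by fun_prop)
    (by fun_prop) 2 (fun x => by have := abs_le.1 (hb x); rw [abs_le]; constructor <;> linarith)
    (fun x => by have := abs_le.1 (hb x); rw [abs_le]; constructor <;> linarith)
  have IN := aux_int_s5 τ ρ hs (fun x => 1 - ε * u x) (fun x => 1 - ε * u x) (by fun_prop)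
    (by fun_prop) 2 (fun x => by have := abs_le.1 (hb x); rw [abs_le]; constructor <;> linarith)
    (fun x => by have := abs_le.1 (hb x); rw [abs_le]; constructor <;> linarith)
  have esum := integral_add IP IN
  have esum2 : (∫ p : E3 × E3, ((1 + ε * u p.1) * ((1 + ε * u p.2) * Lfun τ p.1 p.2)
      + (1 - ε * u p.1) * ((1 - ε * u p.2) * Lfun τ p.1 p.2)) ∂(ρ.prod ρ))
      = 2 * (∫ p : E3 × E3, 1 * (1 * Lfun τ p.1 p.2) ∂(ρ.prod ρ))
        + 2 * ε ^ 2 * ∫ p : E3 × E3, u p.1 * (u p.2 * Lfun τ p.1 p.2) ∂(ρ.prod ρ) := by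
    rw [← integral_const_mul, ← integral_const_mul,
      ← integral_add (I11.const_mul 2) (Iuu.const_mul (2 * ε ^ 2))]
    refine integral_congr_ae (Filter.Eventually.of_forall fun p => ?_)
    dsimp only
    ring
  simp only [one_mul] at esum2
  have hSS : causalAction τ ρ = ∫ p : E3 × E3, Lfun τ p.1 p.2 ∂(ρ.prod ρ) := hS.symm
  rw [eP] at hP
  rw [eN] at hN
  have hQ' : (∫ x, u x * ∫ y, u y * Lfun τ x y ∂ρ ∂ρ)
      = ∫ p : E3 × E3, u p.1 * (u p.2 * Lfun τ p.1 p.2) ∂(ρ.prod ρ) := by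
    rw [hQ]
    simp only [integral_const_mul]
  rw [hQ']
  set Q := ∫ p : E3 × E3, u p.1 * (u p.2 * Lfun τ p.1 p.2) ∂(ρ.prod ρ)
  set m := ∫ x, u x ∂ρ
  set S := causalAction τ ρ
  have hh : S * (1 + ε * m) ^ 2 + S * (1 - ε * m) ^ 2 ≤ 2 * S + 2 * ε ^ 2 * Q := by
    rw [hSS, ← esum2, esum, ← hSS]; exact add_le_add hP hN
  have hfin : S * m ^ 2 * (2 * ε ^ 2) ≤ Q * (2 * ε ^ 2) := by linarith
  have := le_of_mul_le_mul_right hfin (by positivity)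
  have h5 : 0 ≤ S * m ^ 2 := by positivity
  linarith

lemma aux_sph_contDiff :
    ContDiff ℝ 1 (fun v : Fin 2 → ℝ => sphPt (v 0) (v 1)) := by
  rw [contDiff_euclidean]
  intro i
  fin_cases i
  · change ContDiff ℝ 1 (fun v : Fin 2 → ℝ => Real.cos (v 0) * Real.cos (v 1)); fun_prop
  · change ContDiff ℝ 1 (fun v : Fin 2 → ℝ => Real.cos (v 0) * Real.sin (v 1)); fun_prop
  · change ContDiff ℝ 1 (fun v : Fin 2 → ℝ => Real.sin (v 0)); fun_prop

lemma aux_sphere_sub :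
    Sphere2 ⊆ (fun v : Fin 2 → ℝ => sphPt (v 0) (v 1)) '' Icc (fun _ => -Real.pi) (fun _ => Real.pi) := by
  intro x hx
  have hx1 : ‖x‖ = 1 := by simpa [Sphere2] using hx
  have hsq : x 0 ^ 2 + x 1 ^ 2 + x 2 ^ 2 = 1 := by
    have := EuclideanSpace.real_norm_sq_eq x
    rw [hx1, Fin.sum_univ_three] at this
    linarith
  have hz1 : -1 ≤ x 2 := by nlinarith [sq_nonneg (x 0), sq_nonneg (x 1)]
  have hz2 : x 2 ≤ 1 := by nlinarith [sq_nonneg (x 0), sq_nonneg (x 1)]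
  let z : ℂ := ⟨x 0, x 1⟩
  have hz : Real.cos (Real.arcsin (x 2)) = ‖z‖ := by
    rw [Real.cos_arcsin, Complex.norm_eq_sqrt_sq_add_sq]
    congr 1
    change _ = x 0 ^ 2 + x 1 ^ 2
    linarith
  have hpi := Real.pi_pos
  refine ⟨![Real.arcsin (x 2), z.arg], ⟨?_, ?_⟩, ?_⟩
  · intro i
    fin_cases i
    · simpa using by linarith [Real.neg_pi_div_two_le_arcsin (x 2)]
    · simpa using (Complex.neg_pi_lt_arg z).le
  · intro i
    fin_cases i
    · simpa using by linarith [Real.arcsin_le_pi_div_two (x 2)]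
    · simpa using Complex.arg_le_pi z
  · ext i
    fin_cases i
    · change Real.cos (Real.arcsin (x 2)) * Real.cos z.arg = x 0
      rw [hz, Complex.norm_mul_cos_arg]
    · change Real.cos (Real.arcsin (x 2)) * Real.sin z.arg = x 1
      rw [hz, Complex.norm_mul_sin_arg]
    · change Real.sin (Real.arcsin (x 2)) = x 2
      exact Real.sin_arcsin hz1 hz2

lemma aux_sphere_finite : (μH[2] : Measure E3) Sphere2 < ∞ := by
  obtain ⟨K, hK⟩ := LocallyLipschitzOn.exists_lipschitzOnWith_of_compact
    (isCompact_Icc (a := fun _ : Fin 2 => -Real.pi) (b := fun _ => Real.pi))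
    (aux_sph_contDiff.locallyLipschitz.locallyLipschitzOn)
  have h1 := hK.hausdorffMeasure_image_le (d := 2) (by norm_num)
  refine ((measure_mono aux_sphere_sub).trans h1).trans_lt ?_
  have h2 : (μH[2] : Measure (Fin 2 → ℝ)) = volume := by
    have := hausdorffMeasure_pi_real (ι := Fin 2)
    simpa using this
  rw [h2]
  refine ENNReal.mul_lt_top ?_ isCompact_Icc.measure_lt_top
  exact ENNReal.rpow_lt_top_of_nonneg (by norm_num) ENNReal.coe_ne_top

lemma aux_K (Ω : Set E3) (h : Ω → ℝ) (hh : h ∈ KSpace Ω) :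
    ∃ F : E3 → ℝ, Continuous F ∧ ∀ x : Ω, h x = F x := by
  unfold KSpace at hh
  induction hh using Submodule.span_induction with
  | mem f hf =>
    obtain ⟨P, -, hP⟩ := hf
    refine ⟨fun x => MvPolynomial.eval (fun i => x i) P, ?_, hP⟩
    exact (MvPolynomial.continuous_eval P).comp (by fun_prop)
  | zero => exact ⟨0, continuous_const, fun _ => rfl⟩
  | add f g _ _ hf hg =>
    obtain ⟨F, hF, hF'⟩ := hf
    obtain ⟨G, hG, hG'⟩ := hg
    exact ⟨fun x => F x + G x, hF.add hG, fun x => by simp [hF', hG']⟩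
  | smul a f _ hf =>
    obtain ⟨F, hF, hF'⟩ := hf
    exact ⟨fun x => a * F x, hF.const_mul a, fun x => by simp [hF']⟩

set_option maxHeartbeats 1000000 in
/-- Lemma 4.3: positivity of `L_μ⁻¹` on the image of `L_ρ`. -/
theorem stmt_5 (τ : ℝ) (hτ : Real.sqrt 3 < τ) (ρ : Measure E3) (hmin : IsMinimizer τ ρ)
    (Ω : Set E3) (hne : Ω.Nonempty)
    (hopen : ∃ U : Set E3, IsOpen U ∧ Ω = U ∩ Sphere2) (htt : TotallyTimelike τ Ω)
    (ψ : Ω → ℝ) (hψm : Measurable ψ) (hψb : ∃ C : ℝ, ∀ x, |ψ x| ≤ C)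
    (g : Ω → ℝ)
    (hg : ∀ x : Ω, g x = ∫ y, Dfun τ (x : E3) (y : E3) * ψ y
        ∂(Measure.comap Subtype.val ρ : Measure Ω))
    (h : Ω → ℝ) (hh : h ∈ KSpace Ω)
    (hhg : ∀ x : Ω, (∫ y, Dfun τ (x : E3) (y : E3) * h y ∂(surfΩ Ω)) = g x) :
    0 ≤ ∫ x, h x * g x ∂(surfΩ Ω) := by
  obtain ⟨U, hU, hΩ⟩ := hopen
  obtain ⟨C, hC⟩ := hψb
  obtain ⟨F, hF, hhF⟩ := aux_K Ω h hh
  have hΩs : Ω ⊆ Sphere2 := by rw [hΩ]; exact inter_subset_right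
  have hΩm : MeasurableSet Ω := by rw [hΩ]; exact hU.measurableSet.inter aux_sphere_meas
  have hp : IsProbabilityMeasure ρ := hmin.1
  have hemb : MeasurableEmbedding (Subtype.val : Ω → E3) := MeasurableEmbedding.subtype_coe hΩm
  have hfinμ : IsFiniteMeasure (surfΩ Ω) := by
    constructor
    unfold surfΩ
    rw [hemb.comap_apply]
    refine (measure_mono ?_).trans_lt aux_sphere_finite
    rintro _ ⟨x, -, rfl⟩
    exact hΩs x.2
  have hfinρ : IsFiniteMeasure (Measure.comap Subtype.val ρ : Measure Ω) := by
    constructor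
    rw [hemb.comap_apply]
    exact measure_lt_top _ _
  obtain ⟨B, hB⟩ : ∃ B : ℝ, ∀ x : Ω, |h x| ≤ B := by
    have hc : IsCompact Sphere2 := isCompact_sphere 0 1
    obtain ⟨B, hB⟩ := hc.exists_bound_of_continuousOn hF.continuousOn
    exact ⟨B, fun x => by rw [hhF]; exact hB x (hΩs x.2)⟩
  have hhm : Measurable h := by
    have : h = fun x : Ω => F x := funext hhF
    rw [this]
    exact hF.measurable.comp measurable_subtype_coe
  have hDm : Measurable (fun p : Ω × Ω => Dfun τ (p.1 : E3) (p.2 : E3)) :=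
    (aux_D_cont τ).measurable.comp
      ((measurable_subtype_coe.comp measurable_fst).prodMk
        (measurable_subtype_coe.comp measurable_snd))
  have hInt : Integrable (Function.uncurry fun x y : Ω => h x * (Dfun τ (x : E3) (y : E3) * ψ y))
      ((surfΩ Ω).prod (Measure.comap Subtype.val ρ : Measure Ω)) := by
    refine Integrable.of_bound ?_ (B * ((1 + τ ^ 2) * C)) (Filter.Eventually.of_forall ?_)
    · exact ((hhm.comp measurable_fst).mul
        (hDm.mul (hψm.comp measurable_snd))).aestronglyMeasurable
    · rintro ⟨x, y⟩
      simp only [Function.uncurry]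
      have hB0 : 0 ≤ B := (abs_nonneg _).trans (hB x)
      rw [Real.norm_eq_abs, abs_mul, abs_mul]
      exact mul_le_mul (hB _) (mul_le_mul (aux_D_le τ (hΩs x.2) (hΩs y.2)) (hC _)
        (abs_nonneg _) (by positivity)) (by positivity) hB0
  have e1 : (∫ x, h x * g x ∂(surfΩ Ω))
      = ∫ y, ψ y * g y ∂(Measure.comap Subtype.val ρ : Measure Ω) := by
    have a1 : ∀ x, h x * g x = ∫ y, h x * (Dfun τ (x : E3) (y : E3) * ψ y)
        ∂(Measure.comap Subtype.val ρ : Measure Ω) := fun x => by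
      rw [hg, integral_const_mul]
    have a2 : ∀ y, ψ y * g y = ∫ x, h x * (Dfun τ (x : E3) (y : E3) * ψ y) ∂(surfΩ Ω) :=
      fun y => by
        rw [← hhg, ← integral_const_mul]
        refine integral_congr_ae (Filter.Eventually.of_forall fun x => ?_)
        dsimp only
        rw [aux_D_symm τ (y : E3) x]
        ring
    simp only [a1, a2]
    exact integral_integral_swap hInt
  rw [e1]
  classical
  set u : E3 → ℝ := fun x => if hx : x ∈ Ω then ψ ⟨x, hx⟩ else 0 with hu
  have hum : Measurable u := Measurable.dite hψm (g := fun _ => 0) measurable_const hΩm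
  have hu1 : ∀ x : Ω, u x = ψ x := fun x => by simp [hu]
  have hu0 : ∀ x, x ∉ Ω → u x = 0 := fun x hx => by simp [hu, hx]
  obtain ⟨x0, hx0⟩ := hne
  have hC0 : 0 ≤ C := (abs_nonneg _).trans (hC ⟨x0, hx0⟩)
  have huC : ∀ x, |u x| ≤ C := fun x => by
    by_cases hx : x ∈ Ω
    · rw [hu1 ⟨x, hx⟩]; exact hC _
    · rw [hu0 x hx, abs_zero]; exact hC0
  have hQ := aux_Q τ ρ hmin u hum C huC
  have hsub : ∀ f : E3 → ℝ, (∀ x, x ∉ Ω → f x = 0) →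
      (∫ x : Ω, f x ∂(Measure.comap Subtype.val ρ : Measure Ω)) = ∫ x, f x ∂ρ := fun f hf => by
    rw [integral_subtype_comap hΩm]
    exact setIntegral_eq_integral_of_forall_compl_eq_zero hf
  rw [← hsub _ (fun x hx => by rw [hu0 x hx, zero_mul])] at hQ
  refine hQ.trans_eq (integral_congr_ae (Filter.Eventually.of_forall fun x => ?_))
  dsimp only
  rw [hu1, hg, ← hsub _ (fun y hy => by rw [hu0 y hy, zero_mul])]
  congr 1
  refine integral_congr_ae (Filter.Eventually.of_forall fun y => ?_)
  dsimp only
  rw [hu1, Lfun, max_eq_right (htt x x.2 y y.2).le, mul_comm]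
end
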